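/- arXiv:2604.01352 — 4 statements merged into one kernel-verified Lean document; each statement's English description precedes it below -/
import Mathlib

section
/- For every finite POMDP, every topology β on histories, every horizon L ≥ 1, every belief b₀ and every action a₀, the adaptive open-loop optimal Q-value at the empty history lower-bounds the closed-loop optimal Q-value: Q^{AOL}_β L b₀ a₀ [] ≤ Q L b₀ a₀. (Lower-bound half of Theorem 1.) -/
open Finset

set_option maxHeartbeats 1000000

attribute [local instance] Classical.propDecidable

/-- A finite POMDP: transition kernel, observation kernel and reward. -/
structure POMDP (X A Z : Type) where
  T : X → A → PMF X
  O : X → PMF Z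
  r : X → A → ℝ

namespace POMDP

variable {X A Z : Type} [Fintype X] [Fintype A] [Fintype Z]
variable [Nonempty X] [Nonempty A] [Nonempty Z]

/-- Real-valued transition probability. -/
noncomputable def Tr (M : POMDP X A Z) (x : X) (a : A) (x' : X) : ℝ :=
  ((M.T x a) x').toReal

/-- Real-valued observation probability. -/
noncomputable def Ob (M : POMDP X A Z) (x : X) (z : Z) : ℝ :=
  ((M.O x) z).toReal

/-- A belief: nonnegative and sums to one. -/
def IsBelief (b : X → ℝ) : Prop :=
  (∀ x, 0 ≤ b x) ∧ ∑ x, b x = 1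

/-- The propagated belief `b·a`. -/
noncomputable def prop (M : POMDP X A Z) (b : X → ℝ) (a : A) : X → ℝ :=
  fun x' => ∑ x, b x * M.Tr x a x'

/-- Expected reward `R(b,a)`. -/
noncomputable def Rew (M : POMDP X A Z) (b : X → ℝ) (a : A) : ℝ :=
  ∑ x, b x * M.r x a

/-- Observation likelihood `P(z ∣ b, a)`. -/
noncomputable def obsLik (M : POMDP X A Z) (z : Z) (b : X → ℝ) (a : A) : ℝ :=
  ∑ x', M.prop b a x' * M.Ob x' z

/-- Bayes posterior `b^{a,z}`. -/
noncomputable def post (M : POMDP X A Z) (b : X → ℝ) (a : A) (z : Z) : X → ℝ :=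
  fun x' => M.Ob x' z * M.prop b a x' / M.obsLik z b a

/-- Closed-loop optimal value `V`. -/
noncomputable def V (M : POMDP X A Z) : ℕ → (X → ℝ) → ℝ
  | 0, _ => 0
  | n + 1, b =>
    Finset.univ.sup' Finset.univ_nonempty fun a =>
      M.Rew b a +
        ∑ z ∈ Finset.univ.filter (fun z => 0 < M.obsLik z b a),
          M.obsLik z b a * V M n (M.post b a z)

/-- Closed-loop optimal Q-function `Q`. -/
noncomputable def Q (M : POMDP X A Z) : ℕ → (X → ℝ) → A → ℝ
  | 0, _, _ => 0
  | n + 1, b, a =>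
    M.Rew b a +
      ∑ z ∈ Finset.univ.filter (fun z => 0 < M.obsLik z b a),
        M.obsLik z b a * V M n (M.post b a z)

/-- Open-loop optimal value `W`. -/
noncomputable def W (M : POMDP X A Z) : ℕ → (X → ℝ) → ℝ
  | 0, _ => 0
  | n + 1, b =>
    Finset.univ.sup' Finset.univ_nonempty fun a =>
      M.Rew b a + W M n (M.prop b a)

/-- Open-loop Q-function `Q^{OL}`. -/
noncomputable def QOL (M : POMDP X A Z) : ℕ → (X → ℝ) → A → ℝ
  | 0, _, _ => 0
  | n + 1, b, a => M.Rew b a + W M n (M.prop b a)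

/-- Fully observable (MDP) optimal value `U`. -/
noncomputable def U (M : POMDP X A Z) : ℕ → X → ℝ
  | 0, _ => 0
  | n + 1, x =>
    Finset.univ.sup' Finset.univ_nonempty fun a =>
      M.r x a + ∑ x', M.Tr x a x' * U M n x'

/-- QMDP Q-function `Q^{FO}`. -/
noncomputable def QFO (M : POMDP X A Z) : ℕ → (X → ℝ) → A → ℝ
  | 0, _, _ => 0
  | n + 1, b, a => M.Rew b a + ∑ x', M.prop b a x' * U M n x'

/-- Adaptive open-loop optimal value `V^{AOL}_β` on histories of actions and observations. -/
noncomputable def VAOL (M : POMDP X A Z) (β : List (A ⊕ Z) → Bool) :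
    ℕ → (X → ℝ) → List (A ⊕ Z) → ℝ
  | 0, _, _ => 0
  | n + 1, b, h =>
    Finset.univ.sup' Finset.univ_nonempty fun a =>
      M.Rew b a +
        (if β h = true then VAOL M β n (M.prop b a) (h ++ [Sum.inl a])
        else
          ∑ z ∈ Finset.univ.filter (fun z => 0 < M.obsLik z b a),
            M.obsLik z b a * VAOL M β n (M.post b a z) (h ++ [Sum.inl a, Sum.inr z]))

/-- Adaptive open-loop Q-function `Q^{AOL}_β`. -/
noncomputable def QAOL (M : POMDP X A Z) (β : List (A ⊕ Z) → Bool) :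
    ℕ → (X → ℝ) → A → List (A ⊕ Z) → ℝ
  | 0, _, _, _ => 0
  | n + 1, b, a, h =>
    M.Rew b a +
      (if β h = true then VAOL M β n (M.prop b a) (h ++ [Sum.inl a])
      else
        ∑ z ∈ Finset.univ.filter (fun z => 0 < M.obsLik z b a),
          M.obsLik z b a * VAOL M β n (M.post b a z) (h ++ [Sum.inl a, Sum.inr z]))

/-- Point-mass belief at `x'`. -/
noncomputable def delta (x' : X) : X → ℝ := fun x => if x = x' then 1 else 0

/-- Adaptive fully-observable optimal value `V^{AFO}_β` on histories of
actions, observations and states. -/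
noncomputable def VAFO (M : POMDP X A Z) (β : List (A ⊕ (Z ⊕ X)) → Bool) :
    ℕ → (X → ℝ) → List (A ⊕ (Z ⊕ X)) → ℝ
  | 0, _, _ => 0
  | n + 1, b, h =>
    Finset.univ.sup' Finset.univ_nonempty fun a =>
      M.Rew b a +
        (if β h = true then
          ∑ x', M.prop b a x' *
            VAFO M β n (delta x') (h ++ [Sum.inl a, Sum.inr (Sum.inr x')])
        else
          ∑ z ∈ Finset.univ.filter (fun z => 0 < M.obsLik z b a),
            M.obsLik z b a *
              VAFO M β n (M.post b a z) (h ++ [Sum.inl a, Sum.inr (Sum.inl z)]))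

/-- Adaptive fully-observable Q-function `Q^{AFO}_β`. -/
noncomputable def QAFO (M : POMDP X A Z) (β : List (A ⊕ (Z ⊕ X)) → Bool) :
    ℕ → (X → ℝ) → A → List (A ⊕ (Z ⊕ X)) → ℝ
  | 0, _, _, _ => 0
  | n + 1, b, a, h =>
    M.Rew b a +
      (if β h = true then
        ∑ x', M.prop b a x' *
          VAFO M β n (delta x') (h ++ [Sum.inl a, Sum.inr (Sum.inr x')])
      else
        ∑ z ∈ Finset.univ.filter (fun z => 0 < M.obsLik z b a),
          M.obsLik z b a *
            VAFO M β n (M.post b a z) (h ++ [Sum.inl a, Sum.inr (Sum.inl z)]))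

/-- Depth-indexed adaptive open-loop value. -/
noncomputable def VAOLd (M : POMDP X A Z) (β : ℕ → Bool) : ℕ → ℕ → (X → ℝ) → ℝ
  | _, 0, _ => 0
  | d, n + 1, b =>
    Finset.univ.sup' Finset.univ_nonempty fun a =>
      M.Rew b a +
        (if β d = true then VAOLd M β (d + 1) n (M.prop b a)
        else
          ∑ z ∈ Finset.univ.filter (fun z => 0 < M.obsLik z b a),
            M.obsLik z b a * VAOLd M β (d + 1) n (M.post b a z))

/-- Depth-indexed adaptive fully-observable value. -/
noncomputable def VAFOd (M : POMDP X A Z) (β : ℕ → Bool) : ℕ → ℕ → (X → ℝ) → ℝ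
  | _, 0, _ => 0
  | d, n + 1, b =>
    Finset.univ.sup' Finset.univ_nonempty fun a =>
      M.Rew b a +
        (if β d = true then
          ∑ x', M.prop b a x' * VAFOd M β (d + 1) n (delta x')
        else
          ∑ z ∈ Finset.univ.filter (fun z => 0 < M.obsLik z b a),
            M.obsLik z b a * VAFOd M β (d + 1) n (M.post b a z))

/-- Open-loop propagated beliefs `φ₀ = b`, `φ_{i+1} = φ_i · a i` along a
finite action sequence. -/
noncomputable def propFin (M : POMDP X A Z) (b : X → ℝ) {n : ℕ} (a : Fin n → A)
    (j : Fin (n + 1)) : X → ℝ :=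
  Fin.induction b (fun i ih => M.prop ih (a i)) j

end POMDP

namespace POMDP

variable {X A Z : Type} [Fintype X] [Fintype A] [Fintype Z]
variable [Nonempty X] [Nonempty A] [Nonempty Z]

set_option linter.unusedSectionVars false

/-- Unnormalised posterior. -/
noncomputable def upost (M : POMDP X A Z) (b : X → ℝ) (a : A) (z : Z) : X → ℝ :=
  fun x' => M.Ob x' z * M.prop b a x'

lemma Ob_nonneg (M : POMDP X A Z) (x : X) (z : Z) : 0 ≤ M.Ob x z := ENNReal.toReal_nonneg

lemma Ob_sum (M : POMDP X A Z) (x : X) : ∑ z, M.Ob x z = 1 := by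
  unfold Ob
  rw [← ENNReal.toReal_sum (fun z _ => (M.O x).apply_ne_top z), ← tsum_fintype (L := .unconditional Z),
    PMF.tsum_coe, ENNReal.toReal_one]

lemma prop_nonneg (M : POMDP X A Z) {b : X → ℝ} (hb : ∀ x, 0 ≤ b x) (a : A) (x : X) :
    0 ≤ M.prop b a x :=
  Finset.sum_nonneg fun y _ => mul_nonneg (hb y) ENNReal.toReal_nonneg

lemma upost_nonneg (M : POMDP X A Z) {b : X → ℝ} (hb : ∀ x, 0 ≤ b x) (a : A) (z : Z) (x : X) :
    0 ≤ M.upost b a z x :=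
  mul_nonneg (M.Ob_nonneg x z) (M.prop_nonneg hb a x)

lemma obsLik_eq (M : POMDP X A Z) (b : X → ℝ) (a : A) (z : Z) :
    M.obsLik z b a = ∑ x, M.upost b a z x := by
  simp only [obsLik, upost, mul_comm]

lemma obsLik_nonneg (M : POMDP X A Z) {b : X → ℝ} (hb : ∀ x, 0 ≤ b x) (a : A) (z : Z) :
    0 ≤ M.obsLik z b a := by
  rw [obsLik_eq]
  exact Finset.sum_nonneg fun x _ => M.upost_nonneg hb a z x

lemma post_eq (M : POMDP X A Z) (b : X → ℝ) (a : A) (z : Z) :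
    M.post b a z = (M.obsLik z b a)⁻¹ • M.upost b a z := by
  funext x
  simp only [post, upost, Pi.smul_apply, smul_eq_mul]
  ring

lemma prop_smul (M : POMDP X A Z) (c : ℝ) (b : X → ℝ) (a : A) :
    M.prop (c • b) a = c • M.prop b a := by
  funext x
  simp [prop, Finset.mul_sum, mul_assoc]

lemma obsLik_smul (M : POMDP X A Z) (c : ℝ) (b : X → ℝ) (a : A) (z : Z) :
    M.obsLik z (c • b) a = c * M.obsLik z b a := by
  simp [obsLik, prop_smul, Finset.mul_sum, mul_assoc]

lemma Rew_smul (M : POMDP X A Z) (c : ℝ) (b : X → ℝ) (a : A) :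
    M.Rew (c • b) a = c * M.Rew b a := by
  simp [Rew, Finset.mul_sum, mul_assoc]

lemma post_smul (M : POMDP X A Z) {c : ℝ} (hc : 0 < c) (b : X → ℝ) (a : A) (z : Z) :
    M.post (c • b) a z = M.post b a z := by
  funext x
  simp only [post, obsLik_smul, prop_smul, Pi.smul_apply, smul_eq_mul]
  rw [mul_left_comm, mul_div_mul_left _ _ hc.ne']

lemma Rew_add (M : POMDP X A Z) (b c : X → ℝ) (a : A) :
    M.Rew (b + c) a = M.Rew b a + M.Rew c a := by
  simp [Rew, add_mul, Finset.sum_add_distrib]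

lemma upost_add (M : POMDP X A Z) (b c : X → ℝ) (a : A) (z : Z) :
    M.upost (b + c) a z = M.upost b a z + M.upost c a z := by
  funext x
  simp [upost, prop, add_mul, mul_add, Finset.sum_add_distrib]

lemma V_succ (M : POMDP X A Z) (n : ℕ) (b : X → ℝ) :
    M.V (n + 1) b = Finset.univ.sup' Finset.univ_nonempty (fun a => M.Q (n + 1) b a) := rfl

lemma Q_smul (M : POMDP X A Z) (n : ℕ) {c : ℝ} (hc : 0 < c) (b : X → ℝ) (a : A) :
    M.Q n (c • b) a = c * M.Q n b a := by
  cases n with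
  | zero => simp [Q]
  | succ n =>
    simp only [Q, Rew_smul, obsLik_smul, post_smul M hc, mul_pos_iff_of_pos_left hc, mul_add,
      Finset.mul_sum, mul_assoc]

lemma V_smul_le (M : POMDP X A Z) (n : ℕ) {c : ℝ} (hc : 0 < c) (b : X → ℝ) :
    M.V n (c • b) ≤ c * M.V n b := by
  cases n with
  | zero => simp [V]
  | succ n =>
    rw [V_succ, V_succ]
    refine Finset.sup'_le _ _ fun a ha => ?_
    rw [Q_smul M _ hc]
    exact mul_le_mul_of_nonneg_left (Finset.le_sup' (fun a => M.Q (n + 1) b a) ha) hc.le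

lemma V_smul (M : POMDP X A Z) (n : ℕ) {c : ℝ} (hc : 0 < c) (b : X → ℝ) :
    M.V n (c • b) = c * M.V n b := by
  refine le_antisymm (V_smul_le M n hc b) ?_
  have h := V_smul_le M n (inv_pos.2 hc) (c • b)
  rw [inv_smul_smul₀ hc.ne'] at h
  calc c * M.V n b ≤ c * (c⁻¹ * M.V n (c • b)) := mul_le_mul_of_nonneg_left h hc.le
    _ = _ := mul_inv_cancel_left₀ hc.ne' _

lemma V_zero (M : POMDP X A Z) (n : ℕ) : M.V n 0 = 0 := by
  have h := V_smul M n (c := 2) two_pos 0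
  rw [smul_zero] at h
  linarith

lemma Q_eq (M : POMDP X A Z) (n : ℕ) {b : X → ℝ} (hb : ∀ x, 0 ≤ b x) (a : A) :
    M.Q (n + 1) b a = M.Rew b a + ∑ z, M.V n (M.upost b a z) := by
  simp only [Q]
  congr 1
  rw [Finset.sum_filter]
  refine Finset.sum_congr rfl fun z _ => ?_
  split_ifs with h
  · rw [post_eq, V_smul M n (inv_pos.2 h), mul_inv_cancel_left₀ h.ne']
  · have h0 : M.obsLik z b a = 0 := le_antisymm (not_lt.1 h) (M.obsLik_nonneg hb a z)
    rw [obsLik_eq, Finset.sum_eq_zero_iff_of_nonneg fun x _ => M.upost_nonneg hb a z x] at h0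
    have : M.upost b a z = 0 := funext fun x => h0 x (Finset.mem_univ x)
    rw [this, V_zero]

lemma V_add_le (M : POMDP X A Z) (n : ℕ) : ∀ {b c : X → ℝ}, (∀ x, 0 ≤ b x) → (∀ x, 0 ≤ c x) →
    M.V n (b + c) ≤ M.V n b + M.V n c := by
  induction n with
  | zero => intro b c _ _; simp [V]
  | succ n ih =>
    intro b c hb hc
    rw [V_succ, V_succ, V_succ]
    refine Finset.sup'_le _ _ fun a ha => ?_
    have h1 := Finset.le_sup' (fun a => M.Q (n + 1) b a) ha
    have h2 := Finset.le_sup' (fun a => M.Q (n + 1) c a) ha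
    refine le_trans ?_ (add_le_add h1 h2)
    rw [Q_eq M n (b := b + c) (fun x => add_nonneg (hb x) (hc x)), Q_eq M n hb, Q_eq M n hc, Rew_add]
    have h3 : ∑ z, M.V n (M.upost (b + c) a z) ≤
        ∑ z, (M.V n (M.upost b a z) + M.V n (M.upost c a z)) := by
      refine Finset.sum_le_sum fun z _ => ?_
      rw [upost_add]
      exact ih (M.upost_nonneg hb a z) (M.upost_nonneg hc a z)
    rw [Finset.sum_add_distrib] at h3
    linarith

lemma V_sum_le (M : POMDP X A Z) (n : ℕ) (s : Finset Z) (f : Z → X → ℝ)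
    (hf : ∀ z x, 0 ≤ f z x) : M.V n (∑ z ∈ s, f z) ≤ ∑ z ∈ s, M.V n (f z) := by
  induction s using Finset.induction_on with
  | empty => simp [V_zero]
  | insert z s hz ih =>
    rw [Finset.sum_insert hz, Finset.sum_insert hz]
    refine (V_add_le M n (hf z) fun x => ?_).trans (by linarith)
    rw [Finset.sum_apply]
    exact Finset.sum_nonneg fun w _ => hf w x

lemma sum_upost (M : POMDP X A Z) (b : X → ℝ) (a : A) :
    ∑ z, M.upost b a z = M.prop b a := by
  funext x
  simp only [Finset.sum_apply, upost]
  rw [← Finset.sum_mul, Ob_sum, one_mul]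

lemma QAOL_le_of (M : POMDP X A Z) (β : List (A ⊕ Z) → Bool) (n : ℕ)
    (ih : ∀ (b : X → ℝ) (h : List (A ⊕ Z)), (∀ x, 0 ≤ b x) → M.VAOL β n b h ≤ M.V n b)
    (b : X → ℝ) (hb : ∀ x, 0 ≤ b x) (a : A) (h : List (A ⊕ Z)) :
    M.QAOL β (n + 1) b a h ≤ M.Q (n + 1) b a := by
  simp only [QAOL]
  split_ifs with hβ
  · rw [Q_eq M n hb]
    have h1 := ih (M.prop b a) (h ++ [Sum.inl a]) (M.prop_nonneg hb a)
    have h2 := V_sum_le M n Finset.univ (M.upost b a) (M.upost_nonneg hb a)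
    rw [sum_upost] at h2
    linarith
  · simp only [Q]
    refine add_le_add le_rfl (Finset.sum_le_sum fun z _ => ?_)
    refine mul_le_mul_of_nonneg_left (ih _ _ fun x => ?_) (M.obsLik_nonneg hb a z)
    exact div_nonneg (M.upost_nonneg hb a z x) (M.obsLik_nonneg hb a z)

lemma VAOL_le (M : POMDP X A Z) (β : List (A ⊕ Z) → Bool) (n : ℕ) :
    ∀ (b : X → ℝ) (h : List (A ⊕ Z)), (∀ x, 0 ≤ b x) → M.VAOL β n b h ≤ M.V n b := by
  induction n with
  | zero => intro b h _; simp [VAOL, V]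
  | succ n ih =>
    intro b h hb
    rw [V_succ]
    refine Finset.sup'_le _ _ fun a ha => ?_
    exact (QAOL_le_of M β n ih b hb a h).trans (Finset.le_sup' (fun a => M.Q (n + 1) b a) ha)

end POMDP

/-- lower-bound half of Theorem 1: for every finite POMDP,
topology `β` on histories, horizon `L ≥ 1`, belief `b₀` and action `a₀`, the
adaptive open-loop optimal Q-value at the empty history lower-bounds the
closed-loop optimal Q-value. -/
theorem aol_Q_le_Q {X A Z : Type} [Fintype X] [Fintype A] [Fintype Z]
    [Nonempty X] [Nonempty A] [Nonempty Z]
    (M : POMDP X A Z) (β : List (A ⊕ Z) → Bool)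
    (L : ℕ) (hL : 1 ≤ L)
    (b₀ : X → ℝ) (hb₀ : POMDP.IsBelief b₀) (a₀ : A) :
    M.QAOL β L b₀ a₀ [] ≤ M.Q L b₀ a₀ := by
  obtain ⟨n, rfl⟩ : ∃ n, L = n + 1 := ⟨L - 1, by omega⟩
  exact POMDP.QAOL_le_of M β n (POMDP.VAOL_le M β n) b₀ hb₀.1 a₀ []
end

section
/- For every finite POMDP, every horizon L and every belief b, the closed-loop optimal value is at most the expected fully observable (MDP) optimal value under the belief: V L b ≤ ∑_x b x * U L x. (Fully observable extreme case of Theorem 1.) -/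
open Finset

set_option maxHeartbeats 1000000

attribute [local instance] Classical.propDecidable

/-- fully observable extreme of Theorem 1: for every finite
POMDP, horizon `L` and belief `b`, the closed-loop optimal value is at most the
expected fully observable (MDP) optimal value under the belief. -/
theorem closedloop_value_le_qmdp_value {X A Z : Type}
    [Fintype X] [Fintype A] [Fintype Z]
    [Nonempty X] [Nonempty A] [Nonempty Z]
    (M : POMDP X A Z) (L : ℕ) (b : X → ℝ) (hb : POMDP.IsBelief b) :
    M.V L b ≤ ∑ x, b x * M.U L x := by
  obtain ⟨hb, -⟩ := hb
  have hT : ∀ x a x', 0 ≤ M.Tr x a x' := fun _ _ _ => ENNReal.toReal_nonneg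
  have hO : ∀ x z, 0 ≤ M.Ob x z := fun _ _ => ENNReal.toReal_nonneg
  have hO1 : ∀ x, ∑ z, M.Ob x z = 1 := by
    intro x
    unfold POMDP.Ob
    rw [← ENNReal.toReal_sum (fun z _ => (M.O x).apply_ne_top z), ← tsum_fintype (L := .unconditional _),
      PMF.tsum_coe, ENNReal.toReal_one]
  induction L generalizing b with
  | zero => simp [POMDP.V, POMDP.U]
  | succ n ih =>
    rw [POMDP.V]
    refine Finset.sup'_le _ _ fun a _ => ?_
    have hp : ∀ x', 0 ≤ M.prop b a x' := fun x' =>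
      Finset.sum_nonneg fun x _ => mul_nonneg (hb x) (hT x a x')
    have hl : ∀ z, 0 ≤ M.obsLik z b a := fun z =>
      Finset.sum_nonneg fun x' _ => mul_nonneg (hp x') (hO x' z)
    have h1 : ∑ z ∈ Finset.univ.filter (fun z => 0 < M.obsLik z b a),
          M.obsLik z b a * M.V n (M.post b a z)
        ≤ ∑ z ∈ Finset.univ.filter (fun z => 0 < M.obsLik z b a),
          ∑ x', M.prop b a x' * M.Ob x' z * M.U n x' := by
      refine Finset.sum_le_sum fun z hz => ?_
      have hz' : 0 < M.obsLik z b a := (Finset.mem_filter.mp hz).2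
      have h := ih (M.post b a z) fun x' =>
        div_nonneg (mul_nonneg (hO x' z) (hp x')) (hl z)
      refine (mul_le_mul_of_nonneg_left h (hl z)).trans_eq ?_
      rw [Finset.mul_sum]
      refine Finset.sum_congr rfl fun x' _ => ?_
      unfold POMDP.post
      field_simp
    have h2 : ∑ z ∈ Finset.univ.filter (fun z => 0 < M.obsLik z b a),
          ∑ x', M.prop b a x' * M.Ob x' z * M.U n x'
        = ∑ z, ∑ x', M.prop b a x' * M.Ob x' z * M.U n x' := by
      refine Finset.sum_subset (Finset.filter_subset _ _) fun z _ hz => ?_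
      have hz0 : M.obsLik z b a = 0 := by
        refine le_antisymm (not_lt.mp fun h => hz ?_) (hl z)
        exact Finset.mem_filter.mpr ⟨Finset.mem_univ _, h⟩
      refine Finset.sum_eq_zero fun x' _ => ?_
      have := (Finset.sum_eq_zero_iff_of_nonneg
        (fun x' _ => mul_nonneg (hp x') (hO x' z))).mp hz0 x' (Finset.mem_univ _)
      rw [this, zero_mul]
    have h3 : ∑ z, ∑ x', M.prop b a x' * M.Ob x' z * M.U n x'
        = ∑ x', M.prop b a x' * M.U n x' := by
      rw [Finset.sum_comm]
      refine Finset.sum_congr rfl fun x' _ => ?_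
      rw [← Finset.sum_mul, ← Finset.mul_sum, hO1, mul_one]
    have h4 : M.Rew b a + ∑ x', M.prop b a x' * M.U n x'
        = ∑ x, b x * (M.r x a + ∑ x', M.Tr x a x' * M.U n x') := by
      simp only [POMDP.Rew, POMDP.prop, mul_add, Finset.sum_add_distrib, Finset.sum_mul,
        Finset.mul_sum]
      congr 1
      rw [Finset.sum_comm]
      simp only [mul_assoc]
    have h5 : ∑ x, b x * (M.r x a + ∑ x', M.Tr x a x' * M.U n x')
        ≤ ∑ x, b x * M.U (n + 1) x := by
      refine Finset.sum_le_sum fun x _ => mul_le_mul_of_nonneg_left ?_ (hb x)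
      rw [POMDP.U]
      exact Finset.le_sup' (fun a => M.r x a + ∑ x', M.Tr x a x' * M.U n x')
        (Finset.mem_univ a)
    linarith
end

section
/- Fix a finite POMDP, a belief b₀, actions a₀, …, a_{k−1} and observations z₁, …, z_k. Let φ₀ = b₀ and φ_{j+1} = φ_j · a_j be the open-loop propagated beliefs. Assume that for every j ∈ {1, …, k} and every x in the support of φ_j, (O x) z_j > 0, and set m_j = min {(O x) z_j : φ_j x > 0} and M_j = max {(O x) z_j : φ_j x > 0}. Then all posterior beliefs b_j = (b_{j−1})^{a_{j−1}, z_j} are well-defined, and for every x ∈ X: (∏_{j=1}^k m_j / M_j) * φ_k x ≤ b_k x ≤ (∏_{j=1}^k M_j / m_j) * φ_k x. (k-step belief-ratio bound relating the posterior belief to the open-loop propagated belief, from the proof of Theorem 4.) -/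
open Finset

set_option maxHeartbeats 1000000

attribute [local instance] Classical.propDecidable

namespace BeliefRatio

lemma prop_isBelief {X A Z : Type} [Fintype X]
    (M : POMDP X A Z) (b : X → ℝ) (hb : POMDP.IsBelief b) (a : A) :
    POMDP.IsBelief (M.prop b a) := by
  refine ⟨fun x => Finset.sum_nonneg fun y _ => mul_nonneg (hb.1 y) ENNReal.toReal_nonneg, ?_⟩
  have h1 : ∀ y, ∑ x, M.Tr y a x = 1 := by
    intro y
    unfold POMDP.Tr
    rw [← ENNReal.toReal_sum (fun x _ => PMF.apply_ne_top _ _)]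
    have := PMF.tsum_coe (M.T y a)
    rw [tsum_fintype] at this
    rw [this]; simp
  unfold POMDP.prop
  rw [Finset.sum_comm]
  simp_rw [← Finset.mul_sum, h1, mul_one]
  exact hb.2

lemma prop_le {X A Z : Type} [Fintype X]
    (M : POMDP X A Z) (b b' : X → ℝ) (a : A) (c c' : ℝ) (h : ∀ x, c * b x ≤ c' * b' x) (x : X) :
    c * M.prop b a x ≤ c' * M.prop b' a x := by
  unfold POMDP.prop
  rw [Finset.mul_sum, Finset.mul_sum]
  refine Finset.sum_le_sum fun y _ => ?_
  rw [← mul_assoc, ← mul_assoc]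
  exact mul_le_mul_of_nonneg_right (h y) ENNReal.toReal_nonneg

lemma step {X : Type} [Fintype X] (p q o : X → ℝ)
    (hp : POMDP.IsBelief p) (hq : POMDP.IsBelief q) (c C : ℝ) (hc : 0 ≤ c)
    (h1 : ∀ x, c * q x ≤ p x) (h2 : ∀ x, p x ≤ C * q x) (ho : ∀ x, 0 < q x → 0 < o x)
    (m S : ℝ) (hm : m = sInf (o '' {y | 0 < q y})) (hS : S = sSup (o '' {y | 0 < q y})) :
    0 < ∑ x, p x * o x ∧ POMDP.IsBelief (fun x => o x * p x / ∑ x, p x * o x) ∧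
    0 ≤ m / S ∧
    ∀ x, c * (m / S) * q x ≤ o x * p x / ∑ x, p x * o x ∧
      o x * p x / ∑ x, p x * o x ≤ C * (S / m) * q x := by
  have hfin : (o '' {y | 0 < q y}).Finite := Set.toFinite _
  have hne : (o '' {y | 0 < q y}).Nonempty := by
    by_contra hcon
    have : ∀ y, q y = 0 := by
      intro y
      refine le_antisymm (not_lt.mp fun hy => hcon ⟨_, y, hy, rfl⟩) (hq.1 y)
    have h := hq.2
    simp [this] at h
  have hmpos : 0 < m := by
    obtain ⟨y, hy, h⟩ := hne.csInf_mem hfin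
    rw [hm, ← h]; exact ho y hy
  have hml : ∀ x, 0 < q x → m ≤ o x := fun x hx => hm ▸ csInf_le hfin.bddBelow ⟨x, hx, rfl⟩
  have hSl : ∀ x, 0 < q x → o x ≤ S := fun x hx => hS ▸ le_csSup hfin.bddAbove ⟨x, hx, rfl⟩
  have hSpos : 0 < S := by
    obtain ⟨_, y, hy, rfl⟩ := hne
    exact (ho y hy).trans_le (hSl y hy)
  have hz : ∀ x, ¬ 0 < q x → q x = 0 ∧ p x = 0 := by
    intro x hx
    have h0 : q x = 0 := le_antisymm (not_lt.mp hx) (hq.1 x)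
    have := h2 x
    rw [h0, mul_zero] at this
    exact ⟨h0, le_antisymm this (hp.1 x)⟩
  have hlo : ∀ x, p x * m ≤ p x * o x := by
    intro x
    by_cases hx : 0 < q x
    · exact mul_le_mul_of_nonneg_left (hml x hx) (hp.1 x)
    · simp [(hz x hx).2]
  have hhi : ∀ x, p x * o x ≤ p x * S := by
    intro x
    by_cases hx : 0 < q x
    · exact mul_le_mul_of_nonneg_left (hSl x hx) (hp.1 x)
    · simp [(hz x hx).2]
  have hL1 : m ≤ ∑ x, p x * o x := by
    have := Finset.sum_le_sum fun x (_ : x ∈ Finset.univ) => hlo x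
    rwa [← Finset.sum_mul, hp.2, one_mul] at this
  have hL2 : ∑ x, p x * o x ≤ S := by
    have := Finset.sum_le_sum fun x (_ : x ∈ Finset.univ) => hhi x
    rwa [← Finset.sum_mul, hp.2, one_mul] at this
  have hLdef : ∑ x, o x * p x = ∑ x, p x * o x := Finset.sum_congr rfl fun x _ => mul_comm _ _
  generalize (∑ x, p x * o x) = L at *
  have hL : 0 < L := hmpos.trans_le hL1
  refine ⟨hL, ⟨fun x => div_nonneg ?_ hL.le, ?_⟩, (div_pos hmpos hSpos).le, fun x => ⟨?_, ?_⟩⟩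
  · have := hlo x
    have := mul_nonneg (hp.1 x) hmpos.le
    linarith [mul_comm (o x) (p x)]
  · rw [← Finset.sum_div, hLdef, div_self hL.ne']
  · have e : c * (m / S) * q x = (m * (c * q x)) / S := by ring
    rw [e]
    have hx := hlo x
    have hpm := mul_le_mul_of_nonneg_left (h1 x) hmpos.le
    have := mul_nonneg hmpos.le (mul_nonneg hc (hq.1 x))
    exact div_le_div₀ (by linarith [mul_comm (o x) (p x)])
      (by linarith [mul_comm (o x) (p x)]) hL hL2
  · have e : C * (S / m) * q x = (S * (C * q x)) / m := by ring
    rw [e]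
    have hx := hhi x
    have hpm := mul_le_mul_of_nonneg_left (h2 x) hSpos.le
    have := mul_nonneg hSpos.le ((hp.1 x).trans (h2 x))
    exact div_le_div₀ this (by linarith [mul_comm (o x) (p x)]) hmpos hL1

lemma main {X A Z : Type} [Fintype X]
    (M : POMDP X A Z) (k : ℕ)
    (b₀ : X → ℝ) (hb₀ : POMDP.IsBelief b₀)
    (a : Fin k → A) (z : Fin k → Z)
    (φ : Fin (k + 1) → X → ℝ)
    (hφ0 : φ 0 = b₀)
    (hφ : ∀ j : Fin k, φ j.succ = M.prop (φ j.castSucc) (a j))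
    (hobs : ∀ j : Fin k, ∀ x : X, 0 < φ j.succ x → 0 < M.Ob x (z j))
    (bp : Fin (k + 1) → X → ℝ)
    (hbp0 : bp 0 = b₀)
    (hbp : ∀ j : Fin k, bp j.succ = M.post (bp j.castSucc) (a j) (z j)) :
    (POMDP.IsBelief (φ (Fin.last k)) ∧ POMDP.IsBelief (bp (Fin.last k)) ∧
      0 ≤ (∏ j : Fin k,
              sInf ((fun y => M.Ob y (z j)) '' {y | 0 < φ j.succ y}) /
                sSup ((fun y => M.Ob y (z j)) '' {y | 0 < φ j.succ y}))) ∧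
    (∀ j : Fin k, 0 < M.obsLik (z j) (bp j.castSucc) (a j)) ∧
      ∀ x : X,
        (∏ j : Fin k,
              sInf ((fun y => M.Ob y (z j)) '' {y | 0 < φ j.succ y}) /
                sSup ((fun y => M.Ob y (z j)) '' {y | 0 < φ j.succ y})) *
            φ (Fin.last k) x ≤ bp (Fin.last k) x ∧
          bp (Fin.last k) x ≤
            (∏ j : Fin k,
                sSup ((fun y => M.Ob y (z j)) '' {y | 0 < φ j.succ y}) /
                  sInf ((fun y => M.Ob y (z j)) '' {y | 0 < φ j.succ y})) *
              φ (Fin.last k) x := by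
  induction k with
  | zero =>
    have e1 : φ (Fin.last 0) = b₀ := hφ0
    have e2 : bp (Fin.last 0) = b₀ := hbp0
    rw [e1, e2]
    exact ⟨⟨hb₀, hb₀, by simp⟩, fun j => j.elim0, fun x => by simp⟩
  | succ n ih =>
    obtain ⟨⟨ihφ, ihb, ihc⟩, ihL, ihx⟩ := ih (fun j => a j.castSucc) (fun j => z j.castSucc)
      (fun j => φ j.castSucc) hφ0 (fun j => hφ j.castSucc) (fun j => hobs j.castSucc)
      (fun j => bp j.castSucc) hbp0 (fun j => hbp j.castSucc)
    rw [Fin.prod_univ_castSucc, Fin.prod_univ_castSucc]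
    have eφ := hφ (Fin.last n)
    have eb := hbp (Fin.last n)
    have hbφ := prop_isBelief M _ ihφ (a (Fin.last n))
    have hbb := prop_isBelief M _ ihb (a (Fin.last n))
    have hS := step _ _ (fun y => M.Ob y (z (Fin.last n))) hbb hbφ _ _ ihc
      (fun x => by
        have := prop_le M _ _ (a (Fin.last n)) _ 1
          (fun x => (ihx x).1.trans_eq (one_mul _).symm) x
        rwa [one_mul] at this)
      (fun x => by
        have := prop_le M _ _ (a (Fin.last n)) 1 _
          (fun x => (one_mul _).trans_le (ihx x).2) x
        rwa [one_mul] at this)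
      (by rw [← eφ]; exact hobs (Fin.last n)) _ _ rfl rfl
    obtain ⟨s1, s2, s3, s4⟩ := hS
    rw [← eφ] at s3 s4 hbφ
    refine ⟨⟨hbφ, ?_, mul_nonneg ihc s3⟩, ?_, fun x => ?_⟩
    · exact eb ▸ s2
    · intro j
      refine Fin.lastCases ?_ (fun i => ?_) j
      · exact s1
      · exact ihL i
    · rw [← Fin.succ_last, eb]
      exact s4 x

end BeliefRatio

/-- k-step belief-ratio bound from the proof of Theorem 4:
with open-loop propagated beliefs `φ₀ = b₀`, `φ_{j+1} = φ_j · a_j`, if all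
observation likelihoods are positive on the supports of the propagated beliefs,
then all posterior beliefs are well-defined and the final posterior belief is
sandwiched between `(∏ m_j / M_j) φ_k` and `(∏ M_j / m_j) φ_k`. -/
theorem belief_ratio_k_step {X A Z : Type} [Fintype X] [Fintype A] [Fintype Z]
    [Nonempty X] [Nonempty A] [Nonempty Z]
    (M : POMDP X A Z) (k : ℕ)
    (b₀ : X → ℝ) (hb₀ : POMDP.IsBelief b₀)
    (a : Fin k → A) (z : Fin k → Z)
    (φ : Fin (k + 1) → X → ℝ)
    (hφ0 : φ 0 = b₀)
    (hφ : ∀ j : Fin k, φ j.succ = M.prop (φ j.castSucc) (a j))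
    (hobs : ∀ j : Fin k, ∀ x : X, 0 < φ j.succ x → 0 < M.Ob x (z j))
    (bp : Fin (k + 1) → X → ℝ)
    (hbp0 : bp 0 = b₀)
    (hbp : ∀ j : Fin k, bp j.succ = M.post (bp j.castSucc) (a j) (z j)) :
    (∀ j : Fin k, 0 < M.obsLik (z j) (bp j.castSucc) (a j)) ∧
      ∀ x : X,
        (∏ j : Fin k,
              sInf ((fun y => M.Ob y (z j)) '' {y | 0 < φ j.succ y}) /
                sSup ((fun y => M.Ob y (z j)) '' {y | 0 < φ j.succ y})) *
            φ (Fin.last k) x ≤ bp (Fin.last k) x ∧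
          bp (Fin.last k) x ≤
            (∏ j : Fin k,
                sSup ((fun y => M.Ob y (z j)) '' {y | 0 < φ j.succ y}) /
                  sInf ((fun y => M.Ob y (z j)) '' {y | 0 < φ j.succ y})) *
              φ (Fin.last k) x := by
  exact (BeliefRatio.main M k b₀ hb₀ a z φ hφ0 hφ hobs bp hbp0 hbp).2
end

section
/- Fix a finite POMDP with nonnegative rewards (r x a ≥ 0 for all x, a). Let p and q be beliefs and let c ∈ ℝ with 0 < c ≤ 1 satisfy c * p x ≤ q x ≤ (1/c) * p x for every x ∈ X. Then for every horizon n: c * V n p ≤ V n q ≤ (1/c) * V n p and c * W n p ≤ W n q ≤ (1/c) * W n p. (Belief-domination implies value-domination; used to pass the belief-ratio bound to Q-values in the proof of Theorem 4.) -/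
open Finset

set_option maxHeartbeats 1000000

attribute [local instance] Classical.propDecidable

namespace POMDP

theorem aux_prop_nonneg {X A Z : Type} [Fintype X]
    (M : POMDP X A Z) (b : X → ℝ) (hb : ∀ x, 0 ≤ b x) (a : A) (x' : X) : 0 ≤ M.prop b a x' :=
  Finset.sum_nonneg fun x _ => mul_nonneg (hb x) ENNReal.toReal_nonneg

theorem aux_prop_dom {X A Z : Type} [Fintype X]
    (M : POMDP X A Z) (b b' : X → ℝ) (k : ℝ) (h : ∀ x, k * b x ≤ b' x) (a : A) (x' : X) :
    k * M.prop b a x' ≤ M.prop b' a x' := by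
  unfold prop
  rw [Finset.mul_sum]
  refine Finset.sum_le_sum fun x _ => ?_
  rw [← mul_assoc]
  exact mul_le_mul_of_nonneg_right (h x) ENNReal.toReal_nonneg

theorem aux_rew_dom {X A Z : Type} [Fintype X]
    (M : POMDP X A Z) (hr : ∀ (x : X) (a : A), 0 ≤ M.r x a)
    (b b' : X → ℝ) (k : ℝ) (h : ∀ x, k * b x ≤ b' x) (a : A) :
    k * M.Rew b a ≤ M.Rew b' a := by
  unfold Rew
  rw [Finset.mul_sum]
  refine Finset.sum_le_sum fun x _ => ?_
  rw [← mul_assoc]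
  exact mul_le_mul_of_nonneg_right (h x) (hr x a)

theorem aux_obs_dom {X A Z : Type} [Fintype X]
    (M : POMDP X A Z) (b b' : X → ℝ) (k : ℝ) (h : ∀ x, k * b x ≤ b' x) (a : A) (z : Z) :
    k * M.obsLik z b a ≤ M.obsLik z b' a := by
  unfold obsLik
  rw [Finset.mul_sum]
  refine Finset.sum_le_sum fun x _ => ?_
  rw [← mul_assoc]
  exact mul_le_mul_of_nonneg_right (aux_prop_dom M b b' k h a x) ENNReal.toReal_nonneg

theorem aux_post_nonneg {X A Z : Type} [Fintype X]
    (M : POMDP X A Z) (b : X → ℝ) (hb : ∀ x, 0 ≤ b x) (a : A) (z : Z) (x' : X) :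
    0 ≤ M.post b a z x' :=
  div_nonneg (mul_nonneg ENNReal.toReal_nonneg (aux_prop_nonneg M b hb a x'))
    (Finset.sum_nonneg fun x _ => mul_nonneg (aux_prop_nonneg M b hb a x) ENNReal.toReal_nonneg)

/-- One-sided domination for the open-loop value (unnormalized beliefs). -/
theorem aux_W {X A Z : Type} [Fintype X] [Fintype A] [Nonempty A]
    (M : POMDP X A Z) (hr : ∀ (x : X) (a : A), 0 ≤ M.r x a) (n : ℕ) :
    ∀ (b b' : X → ℝ) (k : ℝ), 0 ≤ k → (∀ x, k * b x ≤ b' x) → k * M.W n b ≤ M.W n b' := by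
  induction n with
  | zero => intro b b' k _ _; simp [W]
  | succ n ih =>
    intro b b' k hk h
    simp only [W]
    obtain ⟨a, -, ha⟩ := Finset.exists_mem_eq_sup' (Finset.univ_nonempty (α := A))
      (fun a => M.Rew b a + M.W n (M.prop b a))
    rw [ha]
    refine le_trans ?_ (Finset.le_sup' (fun a => M.Rew b' a + M.W n (M.prop b' a))
      (Finset.mem_univ a))
    have h1 := aux_rew_dom M hr b b' k h a
    have h2 := ih _ _ k hk (aux_prop_dom M b b' k h a)
    simp only [mul_add]
    linarith

/-- One-sided domination for the closed-loop value (unnormalized beliefs). -/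
theorem aux_V {X A Z : Type} [Fintype X] [Fintype A] [Fintype Z] [Nonempty A]
    (M : POMDP X A Z) (hr : ∀ (x : X) (a : A), 0 ≤ M.r x a) (n : ℕ) :
    ∀ (b b' : X → ℝ) (k : ℝ), (∀ x, 0 ≤ b x) → (∀ x, 0 ≤ b' x) → 0 ≤ k →
      (∀ x, k * b x ≤ b' x) → k * M.V n b ≤ M.V n b' := by
  induction n with
  | zero => intro b b' k _ _ _ _; simp [V]
  | succ n ih =>
    intro b b' k hb hb' hk h
    simp only [V]
    obtain ⟨a, -, ha⟩ := Finset.exists_mem_eq_sup' (Finset.univ_nonempty (α := A))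
      (fun a => M.Rew b a + ∑ z ∈ Finset.univ.filter (fun z => 0 < M.obsLik z b a),
          M.obsLik z b a * M.V n (M.post b a z))
    rw [ha]
    refine le_trans ?_ (Finset.le_sup' (fun a => M.Rew b' a +
      ∑ z ∈ Finset.univ.filter (fun z => 0 < M.obsLik z b' a),
          M.obsLik z b' a * M.V n (M.post b' a z)) (Finset.mem_univ a))
    have h1 := aux_rew_dom M hr b b' k h a
    simp only [mul_add]
    refine add_le_add h1 ?_
    rw [Finset.sum_filter, Finset.sum_filter, Finset.mul_sum]
    refine Finset.sum_le_sum fun z _ => ?_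
    have hL := aux_obs_dom M b b' k h a z
    have hn := aux_post_nonneg M b hb a z
    have hn' := aux_post_nonneg M b' hb' a z
    have hV' : 0 ≤ M.V n (M.post b' a z) := by
      have := ih _ _ 0 hn' hn' le_rfl (fun x => by rw [zero_mul]; exact hn' x)
      rwa [zero_mul] at this
    by_cases hp : 0 < M.obsLik z b a
    · by_cases hp' : 0 < M.obsLik z b' a
      · rw [if_pos hp, if_pos hp']
        have key := ih (M.post b a z) (M.post b' a z) (k * M.obsLik z b a / M.obsLik z b' a)
          hn hn' (by positivity) (fun x => by
            have e : k * M.obsLik z b a / M.obsLik z b' a * M.post b a z x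
                = M.Ob x z * (k * M.prop b a x) / M.obsLik z b' a := by
              unfold post
              field_simp
            rw [e]
            unfold post
            exact div_le_div_of_nonneg_right (mul_le_mul_of_nonneg_left
              (aux_prop_dom M b b' k h a x) ENNReal.toReal_nonneg) hp'.le)
        rw [div_mul_eq_mul_div, div_le_iff₀ hp'] at key
        linarith
      · rw [if_neg hp']
        have : k * M.obsLik z b a = 0 := le_antisymm (hL.trans (not_lt.mp hp')) (by positivity)
        rw [if_pos hp, ← mul_assoc, this, zero_mul]
    · rw [if_neg hp, mul_zero]
      split_ifs with hp'
      · exact mul_nonneg hp'.le hV'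
      · exact le_rfl

end POMDP

/-- belief-domination implies value-domination: for a POMDP
with nonnegative rewards and beliefs `p`, `q` with
`c * p x ≤ q x ≤ (1/c) * p x` for all `x` (where `0 < c ≤ 1`), the closed-loop
and the open-loop optimal values satisfy the same domination at every horizon. -/
theorem belief_domination_value_domination {X A Z : Type}
    [Fintype X] [Fintype A] [Fintype Z]
    [Nonempty X] [Nonempty A] [Nonempty Z]
    (M : POMDP X A Z) (hr : ∀ (x : X) (a : A), 0 ≤ M.r x a)
    (p q : X → ℝ) (hp : POMDP.IsBelief p) (hq : POMDP.IsBelief q)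
    (c : ℝ) (hc0 : 0 < c) (hc1 : c ≤ 1)
    (hdom : ∀ x, c * p x ≤ q x ∧ q x ≤ (1 / c) * p x) :
    ∀ n : ℕ,
      (c * M.V n p ≤ M.V n q ∧ M.V n q ≤ (1 / c) * M.V n p) ∧
        (c * M.W n p ≤ M.W n q ∧ M.W n q ≤ (1 / c) * M.W n p) := by
  intro n
  have h1 : ∀ x, c * p x ≤ q x := fun x => (hdom x).1
  have h2 : ∀ x, c * q x ≤ p x := fun x => by
    have := (hdom x).2
    rw [one_div, inv_mul_eq_div, le_div_iff₀ hc0] at this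
    linarith
  have e : ∀ u v : ℝ, c * u ≤ v → u ≤ (1 / c) * v := fun u v huv => by
    rw [one_div, inv_mul_eq_div, le_div_iff₀ hc0]
    linarith
  exact ⟨⟨POMDP.aux_V M hr n p q c hp.1 hq.1 hc0.le h1,
      e _ _ (POMDP.aux_V M hr n q p c hq.1 hp.1 hc0.le h2)⟩,
    ⟨POMDP.aux_W M hr n p q c hc0.le h1, e _ _ (POMDP.aux_W M hr n q p c hc0.le h2)⟩⟩
end
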